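/- arXiv:2411.08270 — 3 statements merged into one kernel-verified Lean document; each statement's English description precedes it below -/
import Mathlib

section
/- Let d be an even integer with d ≥ 4, let q = p^a be a prime power, and let g ∈ GL_d(𝔽_q) have prime order r = d/2 + 1, where r is a primitive prime divisor of q^{d/2} − 1. Set Φ(X) = X^{d/2} + X^{d/2−1} + ⋯ + X + 1 = (X^r − 1)/(X − 1), which is irreducible over 𝔽_q. Then the characteristic polynomial of g is either (X − 1)^{d/2}·Φ(X) or Φ(X)², and the following are equivalent: (i) g is a (d/2)-stingray element; (ii) the characteristic polynomial of g equals (X − 1)^{d/2}·Φ(X); (iii) the trace of g equals d/2 − 1 in 𝔽_q. Moreover, if g is not a (d/2)-stingray element then its trace equals −2 in 𝔽_q. -/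
/-- A matrix `g ∈ GL_d(F)` (viewed through the linear map `v ↦ g *ᵥ v` on `F^d`)
is an `e`-stingray element if `F^d = U ⊕ Fix(g)` where `Fix(g)` is the fixed-point
subspace of `g` and `U` is a `g`-invariant subspace of dimension `e` on which `g` acts
irreducibly. -/
def IsStingray {F : Type*} [Field F] {d : ℕ}
    (g : Matrix (Fin d) (Fin d) F) (e : ℕ) : Prop :=
  ∃ U : Submodule F (Fin d → F),
    Module.finrank F ↥U = e ∧
    Submodule.map g.mulVecLin U ≤ U ∧
    IsCompl U (LinearMap.ker (g.mulVecLin - LinearMap.id)) ∧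
    ∀ W : Submodule F (Fin d → F), W ≤ U → Submodule.map g.mulVecLin W ≤ W →
      W = ⊥ ∨ W = U

open Polynomial in
theorem Matrix.dvd_of_irreducible_of_dvd_charpoly {F n : Type*} [Field F] [Fintype n]
    [DecidableEq n] {M : Matrix n n F} {P Q : F[X]} (hP : Irreducible P)
    (hdvd : P ∣ M.charpoly) (hQ : aeval M Q = 0) : P ∣ Q := by
  have : Fact (Irreducible P) := ⟨hP⟩
  let φ := AdjoinRoot.of P
  have hroot : (M.map φ).charpoly.IsRoot (AdjoinRoot.root P) := by
    rw [Matrix.charpoly_map]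
    exact (AdjoinRoot.isRoot_root P).dvd (Polynomial.map_dvd φ hdvd)
  have hQ' : aeval (M.map φ) (Q.map φ) = 0 := by
    have h := Polynomial.map_aeval_eq_aeval_map (φ := φ) (ψ := φ.mapMatrix (m := n))
      (by ext a i j; simp [Matrix.algebraMap_matrix_apply, apply_ite φ]) Q M
    rw [hQ, map_zero] at h
    exact h.symm
  have hne : Nonempty n := by
    by_contra hn
    rw [not_nonempty_iff] at hn
    exact hP.not_isUnit (isUnit_of_dvd_one (by simpa using hdvd))
  have hmem := spectrum.subset_polynomial_aeval (M.map φ) (Q.map φ)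
    ⟨_, Matrix.mem_spectrum_of_isRoot_charpoly hroot, rfl⟩
  rw [hQ', spectrum.zero_eq, Set.mem_singleton_iff] at hmem
  simp only [eval_map, φ] at hmem
  rwa [← AdjoinRoot.mk_eq_zero, ← AdjoinRoot.aeval_eq, aeval_def, AdjoinRoot.algebraMap_eq]

open Polynomial in
theorem Polynomial.Monic.exists_eq_pow_mul_pow {F : Type*} [Field F] {f A B : F[X]}
    (hf : f.Monic) (hA : Irreducible A) (hB : Irreducible B) (hAm : A.Monic) (hBm : B.Monic)
    (h : ∀ P, Irreducible P → P ∣ f → P ∣ A * B) : ∃ a b : ℕ, f = A ^ a * B ^ b := by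
  obtain ⟨b, g, hg, rfl⟩ :=
    WfDvdMonoid.max_power_factor hf.ne_zero hB
  have hgm : g.Monic := (hBm.pow b).of_mul_monic_left hf
  obtain ⟨a, k, hk, rfl⟩ :=
    WfDvdMonoid.max_power_factor hgm.ne_zero hA
  have hkm : k.Monic := (hAm.pow a).of_mul_monic_left hgm
  have hk1 : k = 1 := by
    by_contra hk1
    obtain ⟨P, hP, hPk⟩ := WfDvdMonoid.exists_irreducible_factor
      (fun hu ↦ hk1 (hkm.eq_one_of_isUnit hu)) hkm.ne_zero
    rcases hP.prime.dvd_or_dvd (h P hP (hPk.mul_left _ |>.mul_left _)) with hPA | hPB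
    · exact hk (((hP.associated_of_dvd hA hPA).symm.dvd).trans hPk)
    · exact hg (((hP.associated_of_dvd hB hPB).symm.dvd).trans (hPk.mul_left _))
  exact ⟨a, b, by rw [hk1]; ring⟩

open Polynomial in
theorem irreducible_cyclotomic_of_primitive {F : Type*} [Field F] [Fintype F] {p a r : ℕ}
    (hp : p.Prime) (hF : Fintype.card F = p ^ a) (hr : r.Prime) (hpr : p.Coprime r)
    (hppd : ∀ i, 1 ≤ i → i < r - 1 → ¬ r ∣ (p ^ a) ^ i - 1) :
    Irreducible (cyclotomic r F) := by
  have : Fact p.Prime := ⟨hp⟩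
  have : Fact r.Prime := ⟨hr⟩
  refine irreducible_of_dvd_cyclotomic_of_natDegree hF hpr dvd_rfl ?_
  rw [natDegree_cyclotomic, Nat.totient_prime hr]
  set u := ZMod.unitOfCoprime _ (hpr.pow_left a)
  refine le_antisymm ?_ ?_
  · by_contra! hlt
    refine hppd _ (orderOf_pos u) hlt ?_
    rw [← Nat.modEq_iff_dvd' (Nat.one_le_pow _ _ (pow_pos hp.pos a)),
      ← ZMod.natCast_eq_natCast_iff]
    have := congrArg Units.val (pow_orderOf_eq_one u)
    rw [Units.val_pow_eq_pow_val] at this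
    push_cast
    simpa only [u, ZMod.coe_unitOfCoprime, Units.val_one, Nat.cast_pow] using this.symm
  · exact Nat.le_of_dvd (by have := hr.two_le; omega) <|
      orderOf_dvd_of_pow_eq_one (ZMod.units_pow_card_sub_one_eq_one r u)

open Polynomial in
theorem Submodule.eq_of_irreducible_aeval_eq_zero {F V : Type*} [Field F] [AddCommGroup V]
    [Module F V] [FiniteDimensional F V] {f : Module.End F V} {P : F[X]} (hP : Irreducible P)
    {U W : Submodule F V} (hUker : U ≤ LinearMap.ker (aeval f P))
    (hU : Module.finrank F U ≤ P.natDegree) (hWU : W ≤ U) (hW : W.map f ≤ W) :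
    W = ⊥ ∨ W = U := by
  refine or_iff_not_imp_left.mpr fun hbot ↦ Submodule.eq_of_le_of_finrank_le hWU (hU.trans ?_)
  have hmaps : ∀ x ∈ W, f x ∈ W := fun x hx ↦ hW (Submodule.mem_map_of_mem hx)
  have : Nontrivial W := Submodule.nontrivial_iff_ne_bot.mpr hbot
  let f' : Module.End F W := f.restrict hmaps
  have haeval : aeval f' P = 0 := by
    ext x
    have key : ∀ Q : F[X], ((aeval f' Q x : W) : V) = aeval f Q x := by
      intro Q
      induction Q using Polynomial.induction_on generalizing x with
      | C c => simp [Module.algebraMap_end_apply]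
      | add p q hp hq => simp [hp, hq]
      | monomial n c h =>
        rw [pow_succ, ← mul_assoc, map_mul _ (_ * _), map_mul _ (_ * _), Module.End.mul_apply,
          Module.End.mul_apply, h, aeval_X, aeval_X]
        rfl
    rw [key]
    exact hUker (hWU x.2)
  have hassoc : Associated (minpoly F f') P :=
    (hP.dvd_iff.mp (minpoly.dvd F f' haeval)).resolve_left (minpoly.not_isUnit F f') |>.symm
  rw [← natDegree_eq_of_degree_eq (degree_eq_degree_of_associated hassoc),
    ← LinearMap.charpoly_natDegree f']
  exact natDegree_le_of_dvd (LinearMap.minpoly_dvd_charpoly f') f'.charpoly_monic.ne_zero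

open Polynomial in
theorem Matrix.aeval_mulVecLin {F : Type*} [Field F] {d : ℕ} (M : Matrix (Fin d) (Fin d) F)
    (P : F[X]) : aeval M.mulVecLin P = (aeval M P).mulVecLin :=
  aeval_algHom_apply (Matrix.toLinAlgEquiv' : Matrix (Fin d) (Fin d) F ≃ₐ[F] _) M P

open Polynomial in
theorem isStingray_of_charpoly_eq {F : Type*} [Field F] {d : ℕ} {M : Matrix (Fin d) (Fin d) F}
    {P : F[X]} {e : ℕ} (hP : Irreducible P) (hPe : P.natDegree = e) (hde : d = e + e)
    (h1 : ¬ P.IsRoot 1) (hM : aeval M ((X - 1) * P) = 0)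
    (hchar : M.charpoly = (X - 1) ^ e * P) : IsStingray M e := by
  have hX : (X - 1 : F[X]) = X - C 1 := by simp
  have hirr : Irreducible (X - 1 : F[X]) := hX ▸ irreducible_X_sub_C 1
  have hcop : IsCoprime (X - 1) P :=
    (hirr.coprime_iff_not_dvd).mpr fun h ↦ h1 (dvd_iff_isRoot.mp (hX ▸ h))
  have hf : aeval M.mulVecLin ((X - 1) * P) = 0 := by
    rw [Matrix.aeval_mulVecLin, hM, Matrix.mulVecLin_zero]
  have hker : LinearMap.ker (M.mulVecLin - LinearMap.id) =
      LinearMap.ker (aeval M.mulVecLin (X - 1 : F[X])) := by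
    simp [Module.End.one_eq_id]
  have hcompl : IsCompl (LinearMap.ker (aeval M.mulVecLin P))
      (LinearMap.ker (M.mulVecLin - LinearMap.id)) := by
    rw [hker]
    refine ⟨disjoint_ker_aeval_of_isCoprime _ hcop.symm, codisjoint_iff.mpr ?_⟩
    rw [sup_comm, sup_ker_aeval_eq_ker_aeval_mul_of_coprime _ hcop, hf, LinearMap.ker_zero]
  have hss : Module.End.IsSemisimple M.mulVecLin :=
    Module.End.isSemisimple_of_squarefree_aeval_eq_zero
      ((squarefree_mul_iff).mpr ⟨hcop.isRelPrime, hirr.squarefree, hP.squarefree⟩) hf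
  have hfix : Module.finrank F (LinearMap.ker (M.mulVecLin - LinearMap.id)) = e := by
    have h := LinearMap.finrank_maxGenEigenspace_eq M.mulVecLin 1
    rw [hss.isFinitelySemisimple.maxGenEigenspace_eq_eigenspace, Matrix.charpoly_mulVecLin, hchar,
      hX, rootMultiplicity_mul (mul_ne_zero (pow_ne_zero _ (X_sub_C_ne_zero 1)) hP.ne_zero),
      rootMultiplicity_X_sub_C_pow, rootMultiplicity_eq_zero h1, add_zero,
      Module.End.eigenspace_def, one_smul, Module.End.one_eq_id] at h
    exact h
  have hU : Module.finrank F (LinearMap.ker (aeval M.mulVecLin P)) = e := by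
    have h := Submodule.finrank_add_eq_of_isCompl hcompl
    rw [hfix, Module.finrank_fin_fun] at h
    omega
  refine ⟨_, hU, ?_, hcompl, fun W hWU hW ↦
    Submodule.eq_of_irreducible_aeval_eq_zero hP le_rfl (hU.trans hPe.symm).le hWU hW⟩
  rintro _ ⟨x, hx, rfl⟩
  have hcomm : aeval M.mulVecLin P * M.mulVecLin = M.mulVecLin * aeval M.mulVecLin P := by
    nth_rewrite 2 [← aeval_X (R := F) M.mulVecLin]
    nth_rewrite 3 [← aeval_X (R := F) M.mulVecLin]
    rw [← map_mul, ← map_mul, mul_comm]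
  have := LinearMap.congr_fun hcomm x
  simp only [Module.End.mul_apply, LinearMap.mem_ker.mp hx, map_zero] at this
  exact this

open Polynomial in
theorem IsStingray.isRoot_charpoly {F : Type*} [Field F] {d : ℕ} {M : Matrix (Fin d) (Fin d) F}
    {e : ℕ} (h : IsStingray M e) (he : e < d) : M.charpoly.IsRoot 1 := by
  obtain ⟨U, hU, -, hcompl, -⟩ := h
  rw [← Matrix.charpoly_mulVecLin, ← Module.End.hasEigenvalue_iff_isRoot_charpoly,
    Module.End.hasEigenvalue_iff, Module.End.eigenspace_def, one_smul, Module.End.one_eq_id]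
  intro hbot
  rw [hbot] at hcompl
  have h := Submodule.finrank_add_eq_of_isCompl hcompl
  rw [hU, finrank_bot, Module.finrank_fin_fun] at h
  omega

/-- Let `d ≥ 4` be even, `q = p^a`, and `g ∈ GL_d(𝔽_q)` of prime order `r = d/2 + 1`,
where `r` is a primitive prime divisor of `q^{d/2} - 1`.  Set
`Φ(X) = X^{d/2} + ⋯ + X + 1 = (X^r - 1)/(X - 1)`, which is irreducible over `𝔽_q`.
Then the characteristic polynomial of `g` is `(X-1)^{d/2}·Φ` or `Φ²`, and the following
are equivalent: (i) `g` is a `(d/2)`-stingray element; (ii) its characteristic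
polynomial is `(X-1)^{d/2}·Φ`; (iii) its trace is `d/2 - 1` in `𝔽_q`.
Moreover if `g` is not a `(d/2)`-stingray element then its trace is `-2`. -/
theorem stmt6 (d p a q r : ℕ) (hd4 : 4 ≤ d) (hdeven : Even d)
    (hp : p.Prime) (ha : 0 < a) (hq : q = p ^ a)
    (F : Type*) [Field F] [Fintype F] (hF : Fintype.card F = q)
    (g : Matrix.GeneralLinearGroup (Fin d) F)
    (hr : r.Prime) (hord : orderOf g = r)
    (hdvd : r ∣ q ^ (d / 2) - 1)
    (hppd : ∀ i, 1 ≤ i → i < d / 2 → ¬ r ∣ q ^ i - 1)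
    (hre : r = d / 2 + 1) :
    Irreducible (∑ i ∈ Finset.range r, (Polynomial.X : Polynomial F) ^ i) ∧
    ((g : Matrix (Fin d) (Fin d) F).charpoly =
        (Polynomial.X - 1) ^ (d / 2) * ∑ i ∈ Finset.range r, Polynomial.X ^ i ∨
      (g : Matrix (Fin d) (Fin d) F).charpoly =
        (∑ i ∈ Finset.range r, Polynomial.X ^ i) ^ 2) ∧
    (IsStingray (g : Matrix (Fin d) (Fin d) F) (d / 2) ↔
      (g : Matrix (Fin d) (Fin d) F).charpoly =
        (Polynomial.X - 1) ^ (d / 2) * ∑ i ∈ Finset.range r, Polynomial.X ^ i) ∧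
    (IsStingray (g : Matrix (Fin d) (Fin d) F) (d / 2) ↔
      Matrix.trace (g : Matrix (Fin d) (Fin d) F) = ((d / 2 : ℕ) : F) - 1) ∧
    (¬ IsStingray (g : Matrix (Fin d) (Fin d) F) (d / 2) →
      Matrix.trace (g : Matrix (Fin d) (Fin d) F) = -2) := by
  have hr2 := hr.two_le
  have hde : d = d / 2 + d / 2 := by obtain ⟨k, rfl⟩ := hdeven; omega
  set e := d / 2
  have he2 : 2 ≤ e := by omega
  have : Fact r.Prime := ⟨hr⟩
  have hpr : p.Coprime r := by
    refine (Nat.coprime_primes hp hr).mpr ?_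
    rintro rfl
    have h1 : p ∣ q ^ e := (hq ▸ dvd_pow_self p ha.ne').trans (dvd_pow_self q (by omega))
    have hq0 : 1 ≤ q ^ e := Nat.one_le_pow _ _ (hq ▸ pow_pos hp.pos a)
    have := (Nat.dvd_sub_iff_right hq0 h1).mp hdvd
    exact hp.one_lt.ne' (Nat.dvd_one.mp this)
  have hr0 : (r : F) ≠ 0 := by
    have : Fact p.Prime := ⟨hp⟩
    have := charP_of_card_eq_prime_pow (hF.trans hq)
    rw [Ne, CharP.cast_eq_zero_iff F p]
    exact (hp.coprime_iff_not_dvd).mp hpr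
  have hΦc : ∑ i ∈ Finset.range r, (Polynomial.X : Polynomial F) ^ i =
      Polynomial.cyclotomic r F := (Polynomial.cyclotomic_prime F r).symm
  have hmul : (Polynomial.X - 1) * Polynomial.cyclotomic r F = Polynomial.X ^ r - 1 := by
    rw [mul_comm, Polynomial.cyclotomic_prime_mul_X_sub_one]
  rw [hΦc]
  set Φ := Polynomial.cyclotomic r F
  have hΦ : Irreducible Φ := irreducible_cyclotomic_of_primitive hp (hF.trans hq) hr hpr
    fun i hi hi' ↦ hq ▸ hppd i hi (by omega)
  have hΦm : Φ.Monic := Polynomial.cyclotomic.monic r F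
  have hΦd : Φ.natDegree = e := by
    rw [Polynomial.natDegree_cyclotomic, Nat.totient_prime hr]; omega
  have hΦ1 : ¬ Φ.IsRoot 1 := by
    rw [Polynomial.IsRoot, Polynomial.eval_one_cyclotomic_prime]
    exact hr0
  have hΦn : Φ.nextCoeff = 1 := by
    rw [Polynomial.nextCoeff_of_natDegree_pos (by omega), hΦd, ← hΦc, Polynomial.finsetSum_coeff]
    simp [Polynomial.coeff_X_pow]
    omega
  have hX : (Polynomial.X - 1 : Polynomial F) = Polynomial.X - Polynomial.C 1 := by simp
  have hXm : (Polynomial.X - 1 : Polynomial F).Monic := hX ▸ Polynomial.monic_X_sub_C 1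
  have hXirr : Irreducible (Polynomial.X - 1 : Polynomial F) :=
    hX ▸ Polynomial.irreducible_X_sub_C 1
  have hXd : (Polynomial.X - 1 : Polynomial F).natDegree = 1 :=
    hX ▸ Polynomial.natDegree_X_sub_C 1
  have hXn : (Polynomial.X - 1 : Polynomial F).nextCoeff = -1 :=
    hX ▸ Polynomial.nextCoeff_X_sub_C 1
  set M : Matrix (Fin d) (Fin d) F := (g : Matrix (Fin d) (Fin d) F) with hMdef
  have hMr : Polynomial.aeval M ((Polynomial.X - 1) * Φ) = 0 := by
    have h : M ^ r = 1 := by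
      rw [hMdef, ← Units.val_pow_eq_pow_val, ← hord, pow_orderOf_eq_one, Units.val_one]
    rw [hmul]
    simp [h]
  have hM1 : M ≠ 1 := by
    intro h
    have hg : g = 1 := Units.ext h
    rw [hg, orderOf_one] at hord
    omega
  have hchar : M.charpoly = (Polynomial.X - 1) ^ e * Φ ∨ M.charpoly = Φ ^ 2 := by
    obtain ⟨a, b, hab⟩ := M.charpoly_monic.exists_eq_pow_mul_pow hXirr hΦ hXm hΦm
      fun P hP hPd ↦ Matrix.dvd_of_irreducible_of_dvd_charpoly hP hPd hMr
    have hdeg := congrArg Polynomial.natDegree hab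
    rw [Matrix.charpoly_natDegree_eq_dim, Fintype.card_fin,
      (hXm.pow a).natDegree_mul (hΦm.pow b), hXm.natDegree_pow, hΦm.natDegree_pow, hXd, hΦd] at hdeg
    have hb : b < 3 := by
      by_contra! hb
      have := Nat.mul_le_mul_right e hb
      omega
    interval_cases b
    · exfalso
      have hcop : IsCoprime ((Polynomial.X - 1) ^ a) Φ := by
        refine IsCoprime.pow_left ?_
        exact (hXirr.coprime_iff_not_dvd).mpr
          fun h ↦ hΦ1 (Polynomial.dvd_iff_isRoot.mp (hX ▸ h))
      have hmin : minpoly F M ∣ Polynomial.X - 1 := by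
        refine IsCoprime.dvd_of_dvd_mul_right ?_ (minpoly.dvd F M hMr)
        refine hcop.of_isCoprime_of_dvd_left ?_
        simpa [hab] using Matrix.minpoly_dvd_charpoly M
      obtain ⟨c, hc⟩ := hmin
      apply hM1
      have := congrArg (Polynomial.aeval M) hc
      rw [map_mul, minpoly.aeval, zero_mul] at this
      simpa [sub_eq_zero] using this
    · left
      rw [hab, pow_one, show a = e by omega]
    · right
      rw [hab, show a = 0 by omega, pow_zero, one_mul]
  have htr1 : M.charpoly = (Polynomial.X - 1) ^ e * Φ → M.trace = (e : F) - 1 := by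
    intro h
    rw [Matrix.trace_eq_neg_charpoly_nextCoeff, h, (hXm.pow e).nextCoeff_mul hΦm,
      hXm.nextCoeff_pow, hXn, hΦn]
    simp
    ring
  have htr2 : M.charpoly = Φ ^ 2 → M.trace = -2 := by
    intro h
    rw [Matrix.trace_eq_neg_charpoly_nextCoeff, h, hΦm.nextCoeff_pow, hΦn]
    simp
  have hst2 : M.charpoly = Φ ^ 2 → ¬ IsStingray M e := by
    intro h hst
    have h1 := hst.isRoot_charpoly (by omega)
    rw [h, Polynomial.IsRoot, Polynomial.eval_pow] at h1
    exact hΦ1 (pow_eq_zero_iff two_ne_zero |>.mp h1)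
  have hst1 : M.charpoly = (Polynomial.X - 1) ^ e * Φ → IsStingray M e :=
    isStingray_of_charpoly_eq hΦ hΦd hde hΦ1 hMr
  have htrne : (e : F) - 1 ≠ -2 := by
    intro h
    apply hr0
    rw [hre]
    push_cast
    linear_combination h
  refine ⟨hΦ, hchar, ⟨fun h ↦ hchar.resolve_right fun h2 ↦ hst2 h2 h, hst1⟩, ?_, ?_⟩
  · refine ⟨fun h ↦ htr1 (hchar.resolve_right fun h2 ↦ hst2 h2 h), fun h ↦ ?_⟩
    exact hst1 (hchar.resolve_right fun h2 ↦ htrne (h.symm.trans (htr2 h2)))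
  · exact fun h ↦ htr2 (hchar.resolve_left fun h1 ↦ h (hst1 h1))
end

section
/- Let n ≥ 5, let p be a prime, q = p^a, let δ = 1 if p ∤ n and δ = 2 if p ∣ n, set d = n − δ, and assume d is even. Let V be the fully deleted permutation module for A_n over 𝔽_q, and let g ∈ A_n have order r, where r is a primitive prime divisor of q^{d/2} − 1. Then exactly one of the following holds: (1) r = d + 1, p ∤ n, n = d + 1, and g is an n-cycle; (2) r = d + 1, p ∣ n, n = d + 2, and g is an (n−1)-cycle with one fixed point; (3) r = d/2 + 1 and g is an r-cycle with n − r fixed points; (4) r = d/2 + 1 = n/2, p = 2, and g is a product of two disjoint r-cycles. Moreover, the action of g on V is a (d/2)-stingray element if and only if case (3) holds. -/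
/-! The fully deleted permutation module `V = W/(W ∩ D)` for `Sₙ` over a finite field,
with the induced coordinate-permutation action, and stingray elements. -/

/-- The linear map `(x₁, …, xₙ) ↦ ∑ᵢ xᵢ` on `Fⁿ`. -/
noncomputable def sumCoords (F : Type*) [Field F] (n : ℕ) : (Fin n → F) →ₗ[F] F :=
  ∑ i : Fin n, LinearMap.proj i

/-- `W = {x ∈ Fⁿ : ∑ᵢ xᵢ = 0}`. -/
noncomputable def Wsub (F : Type*) [Field F] (n : ℕ) : Submodule F (Fin n → F) :=
  LinearMap.ker (sumCoords F n)

/-- `D`, the span of the all-ones vector in `Fⁿ`. -/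
noncomputable def Dsub (F : Type*) [Field F] (n : ℕ) : Submodule F (Fin n → F) :=
  Submodule.span F {fun _ => (1 : F)}

/-- `W ∩ D`, viewed as a submodule of `W`. -/
noncomputable def Nsub (F : Type*) [Field F] (n : ℕ) : Submodule F ↥(Wsub F n) :=
  (Wsub F n ⊓ Dsub F n).comap (Wsub F n).subtype

/-- The fully deleted permutation module `V = W/(W ∩ D)` over `F`. -/
abbrev DelMod (F : Type*) [Field F] (n : ℕ) := ↥(Wsub F n) ⧸ Nsub F n

/-- The action of a permutation `σ` on `W` (permuting coordinates, `x ↦ x ∘ σ⁻¹`). -/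
noncomputable def permW (F : Type*) [Field F] (n : ℕ) (σ : Equiv.Perm (Fin n)) :
    ↥(Wsub F n) →ₗ[F] ↥(Wsub F n) :=
  LinearMap.restrict (LinearMap.funLeft F F ⇑σ⁻¹)
    (p := Wsub F n) (q := Wsub F n) (by
      intro x hx
      simp only [Wsub, LinearMap.mem_ker, sumCoords, LinearMap.sum_apply,
        LinearMap.proj_apply, LinearMap.funLeft_apply] at hx ⊢
      simpa using (Equiv.sum_comp σ⁻¹ x).trans hx)

/-- The induced action of a permutation `σ` on the fully deleted permutation module. -/
noncomputable def permDel (F : Type*) [Field F] (n : ℕ) (σ : Equiv.Perm (Fin n)) :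
    Module.End F (DelMod F n) :=
  Submodule.mapQ (Nsub F n) (Nsub F n) (permW F n σ) (by
    intro x hx
    have hD : (x : Fin n → F) ∈ Dsub F n := hx.2
    refine Submodule.mem_comap.mpr (Submodule.mem_inf.mpr ⟨?_, ?_⟩)
    · exact (permW F n σ x).2
    · rw [Submodule.subtype_apply]
      have hcoe : (permW F n σ x : Fin n → F)
          = LinearMap.funLeft F F ⇑σ⁻¹ (x : Fin n → F) :=
        LinearMap.restrict_coe_apply _ _ _
      rw [hcoe]
      rw [Dsub, Submodule.mem_span_singleton] at hD ⊢
      obtain ⟨c, hc⟩ := hD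
      refine ⟨c, ?_⟩
      funext i
      simpa using congrFun hc (σ⁻¹ i))

/-- A linear endomorphism `g` of an `F`-vector space `M` is an `e`-stingray element if
`M = U ⊕ Fix(g)` where `Fix(g)` is the fixed-point subspace of `g` and `U` is a
`g`-invariant subspace of dimension `e` on which `g` acts irreducibly. -/
def IsStingrayOn (F : Type*) [Field F] {M : Type*} [AddCommGroup M] [Module F M]
    (g : Module.End F M) (e : ℕ) : Prop :=
  ∃ U : Submodule F M,
    Module.finrank F ↥U = e ∧
    Submodule.map g U ≤ U ∧
    IsCompl U (LinearMap.ker (g - LinearMap.id)) ∧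
    ∀ W : Submodule F M, W ≤ U → Submodule.map g W ≤ W → W = ⊥ ∨ W = U

/-- Case (1): `r = d + 1`, `p ∤ n`, `n = d + 1`, and `g` is an `n`-cycle. -/
def Case1 (n p d r : ℕ) (g : Equiv.Perm (Fin n)) : Prop :=
  r = d + 1 ∧ ¬ p ∣ n ∧ n = d + 1 ∧ g.IsCycle ∧ g.support.card = n

/-- Case (2): `r = d + 1`, `p ∣ n`, `n = d + 2`, and `g` is an `(n-1)`-cycle (with one
fixed point). -/
def Case2 (n p d r : ℕ) (g : Equiv.Perm (Fin n)) : Prop :=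
  r = d + 1 ∧ p ∣ n ∧ n = d + 2 ∧ g.IsCycle ∧ g.support.card = n - 1

/-- Case (3): `r = d/2 + 1` and `g` is an `r`-cycle (with `n - r` fixed points). -/
def Case3 (n d r : ℕ) (g : Equiv.Perm (Fin n)) : Prop :=
  r = d / 2 + 1 ∧ g.IsCycle ∧ g.support.card = r

/-- Case (4): `r = d/2 + 1 = n/2`, `p = 2`, and `g` is a product of two disjoint
`r`-cycles. -/
def Case4 (n p d r : ℕ) (g : Equiv.Perm (Fin n)) : Prop :=
  r = d / 2 + 1 ∧ r = n / 2 ∧ p = 2 ∧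
    ∃ c₁ c₂ : Equiv.Perm (Fin n), c₁.IsCycle ∧ c₂.IsCycle ∧
      c₁.support.card = r ∧ c₂.support.card = r ∧ c₁.Disjoint c₂ ∧ g = c₁ * c₂

theorem Module.End.pow_apply_of_apply_eq_add {R M : Type*} [Semiring R] [AddCommMonoid M]
    [Module R M] {T : Module.End R M} {x y : M} (hx : T x = x + y) (hy : T y = y) (k : ℕ) :
    (T ^ k) x = x + k • y := by
  induction k with
  | zero => simp
  | succ k ih =>
    rw [pow_succ', Module.End.mul_apply, ih, map_add, map_nsmul, hx, hy, succ_nsmul']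
    abel

section LinearAlgebra

variable {F M : Type*} [Field F] [AddCommGroup M] [Module F M] {T : Module.End F M} {r : ℕ}

theorem Module.End.mem_ker_sub_id {x : M} : x ∈ LinearMap.ker (T - LinearMap.id) ↔ T x = x := by
  simp [sub_eq_zero]

theorem Module.End.eq_zero_of_apply_eq_add (hT : T ^ r = 1) (hr : (r : F) ≠ 0) {x y : M}
    (hx : T x = x + y) (hy : T y = y) : y = 0 := by
  have h := Module.End.pow_apply_of_apply_eq_add hx hy r
  rw [hT, Module.End.one_apply, left_eq_add, ← Nat.cast_smul_eq_nsmul F] at h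
  exact (smul_eq_zero.mp h).resolve_left hr

theorem Module.End.isCompl_range_ker_sub_id [FiniteDimensional F M] (hT : T ^ r = 1)
    (hr : (r : F) ≠ 0) :
    IsCompl (LinearMap.range (T - LinearMap.id)) (LinearMap.ker (T - LinearMap.id)) := by
  have hd : Disjoint (LinearMap.range (T - LinearMap.id)) (LinearMap.ker (T - LinearMap.id)) := by
    rw [Submodule.disjoint_def]
    rintro y ⟨x, rfl⟩ hy
    exact eq_zero_of_apply_eq_add hT hr (x := x) (by simp) (mem_ker_sub_id.mp hy)
  refine ⟨hd, codisjoint_iff.mpr (Submodule.eq_top_of_disjoint _ _ ?_ hd)⟩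
  exact (LinearMap.finrank_range_add_finrank_ker _).ge

theorem Module.End.dvd_card_pow_finrank_sub_one [Fintype F] [FiniteDimensional F M]
    (hr : r.Prime) (hT : T ^ r = 1) {W : Submodule F M} (hW : W.map T ≤ W)
    (hfix : ∀ x ∈ W, T x = x → x = 0) :
    r ∣ Fintype.card F ^ Module.finrank F W - 1 := by
  have : Fact r.Prime := ⟨hr⟩
  have : Finite M := Module.finite_of_finite F
  have : Fintype W := Fintype.ofFinite W
  let f : Function.End W := fun x => ⟨T x, hW ⟨x, x.2, rfl⟩⟩
  have hpow : ∀ (k : ℕ) (x : W), (((f ^ k) x : W) : M) = (T ^ k) x := by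
    intro k
    induction k with
    | zero => intro x; rfl
    | succ k ih =>
      intro x
      rw [pow_succ', pow_succ', Module.End.mul_apply, ← ih]
      rfl
  have hf : f ^ r ^ 1 = 1 := by
    funext x
    apply Subtype.ext
    rw [hpow, pow_one, hT]
    rfl
  classical
  have hmod := Equiv.Perm.card_fixedPoints_modEq hf
  have hone : Fintype.card f.fixedPoints = 1 := by
    rw [Fintype.card_eq_one_iff]
    refine ⟨⟨0, Subtype.ext (map_zero T)⟩, ?_⟩
    rintro ⟨x, hx⟩
    exact Subtype.ext (Subtype.ext (hfix x x.2 (congrArg Subtype.val hx)))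
  rw [hone, Module.card_eq_pow_finrank (K := F)] at hmod
  exact (Nat.modEq_iff_dvd' (Nat.one_le_pow _ _ Fintype.card_pos)).mp hmod.symm

/-- Under the primitive prime divisor condition, every invariant subspace without nonzero fixed
vectors is zero or has dimension at least `e`. -/
theorem Module.End.eq_bot_or_le_finrank [Fintype F] [FiniteDimensional F M] {e : ℕ}
    (hr : r.Prime) (hT : T ^ r = 1)
    (hppd : ∀ i, 1 ≤ i → i < e → ¬ r ∣ Fintype.card F ^ i - 1)
    {W : Submodule F M} (hW : W.map T ≤ W) (hfix : ∀ x ∈ W, T x = x → x = 0) :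
    W = ⊥ ∨ e ≤ Module.finrank F W := by
  rw [← Submodule.finrank_eq_zero (R := F)]
  by_contra! h
  exact hppd _ (Nat.one_le_iff_ne_zero.mpr h.1) h.2
    (dvd_card_pow_finrank_sub_one hr hT hW hfix)

theorem isStingrayOn_of_finrank_range_le [Fintype F] [FiniteDimensional F M] {e : ℕ}
    (hr : r.Prime) (hT : T ^ r = 1) (hrF : (r : F) ≠ 0)
    (hppd : ∀ i, 1 ≤ i → i < e → ¬ r ∣ Fintype.card F ^ i - 1) (hT1 : T ≠ 1)
    (hle : Module.finrank F (LinearMap.range (T - LinearMap.id)) ≤ e) :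
    IsStingrayOn F T e := by
  have hc := Module.End.isCompl_range_ker_sub_id hT hrF
  have hfix : ∀ x ∈ LinearMap.range (T - LinearMap.id), T x = x → x = 0 := fun x hx h =>
    Submodule.disjoint_def.mp hc.disjoint x hx (Module.End.mem_ker_sub_id.mpr h)
  have hinv : (LinearMap.range (T - LinearMap.id)).map T ≤ LinearMap.range (T - LinearMap.id) := by
    rintro _ ⟨_, ⟨x, rfl⟩, rfl⟩
    exact ⟨T x, by simp⟩
  have hne : LinearMap.range (T - LinearMap.id) ≠ ⊥ := by
    rw [Ne, LinearMap.range_eq_bot, sub_eq_zero]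
    exact hT1
  have hdim := hle.antisymm ((Module.End.eq_bot_or_le_finrank hr hT hppd hinv hfix).resolve_left hne)
  refine ⟨_, hdim, hinv, hc, fun W hWU hW => ?_⟩
  refine (Module.End.eq_bot_or_le_finrank hr hT hppd hW fun x hx => hfix x (hWU hx)).imp_right ?_
  exact fun h => Submodule.eq_of_le_of_finrank_le hWU (hdim.trans_le h)

theorem IsStingrayOn.finrank_eq_of_fixed_eq_zero {e : ℕ} (h : IsStingrayOn F T e)
    (hfix : ∀ x, T x = x → x = 0) : Module.finrank F M = e := by
  obtain ⟨U, hU, -, hc, -⟩ := h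
  have hk : LinearMap.ker (T - LinearMap.id) = ⊥ :=
    (Submodule.eq_bot_iff _).mpr fun x hx => hfix x (Module.End.mem_ker_sub_id.mp hx)
  rw [hk] at hc
  rw [← hU, eq_top_of_isCompl_bot hc, finrank_top]

end LinearAlgebra

section DeletedPermutationModule

variable {F : Type*} [Field F] {n : ℕ} {σ : Equiv.Perm (Fin n)} {r : ℕ}

theorem mem_Wsub {x : Fin n → F} : x ∈ Wsub F n ↔ ∑ i, x i = 0 := by
  simp [Wsub, sumCoords]

theorem mem_Nsub {x : Wsub F n} : x ∈ Nsub F n ↔ ∃ c : F, ∀ i, (x : Fin n → F) i = c := by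
  simp only [Nsub, Submodule.mem_comap, Submodule.mem_inf, Submodule.subtype_apply, x.2, true_and,
    Dsub, Submodule.mem_span_singleton, funext_iff, Pi.smul_apply, smul_eq_mul, mul_one]
  exact exists_congr fun c => forall_congr' fun i => eq_comm

theorem permW_apply (x : Wsub F n) (i : Fin n) :
    (permW F n σ x : Fin n → F) i = (x : Fin n → F) (σ⁻¹ i) := rfl

theorem permDel_mk (x : Wsub F n) :
    permDel F n σ (Submodule.Quotient.mk x) = Submodule.Quotient.mk (permW F n σ x) := rfl

theorem permW_pow (k : ℕ) : permW F n σ ^ k = permW F n (σ ^ k) := by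
  induction k with
  | zero => rfl
  | succ k ih =>
    ext x i
    rw [pow_succ, Module.End.mul_apply, ih, permW_apply, permW_apply, permW_apply, ← Equiv.Perm.mul_apply,
      ← mul_inv_rev, ← pow_succ]

theorem permDel_pow_eq_one (hσ : σ ^ r = 1) : permDel F n σ ^ r = 1 := by
  have h : ∀ (k : ℕ) (x : Wsub F n), (permDel F n σ ^ k) (Submodule.Quotient.mk x) =
      Submodule.Quotient.mk ((permW F n σ ^ k) x) := by
    intro k x
    induction k with
    | zero => rfl
    | succ k ih => rw [pow_succ', pow_succ', Module.End.mul_apply, ih, permDel_mk]; rfl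
  refine LinearMap.ext fun v => ?_
  obtain ⟨x, rfl⟩ := Submodule.Quotient.mk_surjective _ v
  rw [h, permW_pow, hσ]
  rfl

theorem permDel_ne_one (hn : 5 ≤ n) (hσ : σ ≠ 1) : permDel F n σ ≠ 1 := by
  intro h
  obtain ⟨i, hi⟩ : ∃ i, σ i ≠ i := by
    by_contra! hc
    exact hσ (Equiv.ext hc)
  have hi' : σ.symm i ≠ i := by rwa [Ne, Equiv.symm_apply_eq, eq_comm]
  obtain ⟨j, hj⟩ : ∃ j, j ∉ ({i, σ.symm i} : Finset (Fin n)) := by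
    by_contra! hc
    have := Finset.card_le_card (fun a _ => hc a : Finset.univ ⊆ ({i, σ.symm i} : Finset (Fin n)))
    have := Finset.card_le_two (a := i) (b := σ.symm i)
    simp at *
    omega
  obtain ⟨k, hk⟩ : ∃ k, k ∉ ({i, j, σ i, σ j} : Finset (Fin n)) := by
    by_contra! hc
    have := Finset.card_le_card
      (fun a _ => hc a : Finset.univ ⊆ ({i, j, σ i, σ j} : Finset (Fin n)))
    have := Finset.card_le_four (a := i) (b := j) (c := σ i) (d := σ j)
    rw [Finset.card_univ, Fintype.card_fin] at *
    omega
  simp only [Finset.mem_insert, Finset.mem_singleton, not_or] at hj hk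
  let x : Wsub F n := ⟨Pi.single i 1 - Pi.single j 1, by simp [mem_Wsub]⟩
  have hx : permW F n σ x - x ∈ Nsub F n := by
    rw [← Submodule.Quotient.eq, ← permDel_mk, h]
    rfl
  obtain ⟨c, hc⟩ := mem_Nsub.mp hx
  have hval : ∀ m, (Pi.single i 1 - Pi.single j 1 : Fin n → F) (σ⁻¹ m) -
      (Pi.single i 1 - Pi.single j 1 : Fin n → F) m = c := hc
  have h1 := hval i
  have h2 := hval k
  have hki : σ.symm k ≠ i := by rw [Ne, Equiv.symm_apply_eq]; exact hk.2.2.1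
  have hkj : σ.symm k ≠ j := by rw [Ne, Equiv.symm_apply_eq]; exact hk.2.2.2
  simp [hk, hki, hkj] at h2
  simp [hi', Ne.symm hj.1, Ne.symm hj.2, ← h2] at h1

theorem finrank_range_permDel_sub_id_le :
    Module.finrank F (LinearMap.range (permDel F n σ - LinearMap.id)) ≤ σ.support.card - 1 := by
  rcases eq_or_ne σ 1 with rfl | hσ
  · have : permDel F n (1 : Equiv.Perm (Fin n)) - LinearMap.id = 0 := by
      rw [sub_eq_zero, ← pow_one (permDel F n 1), permDel_pow_eq_one (one_pow 1)]
      rfl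
    rw [this, LinearMap.range_zero]
    simp
  obtain ⟨i₀, hi₀⟩ := Finset.nonempty_iff_ne_empty.mpr (Equiv.Perm.support_eq_empty_iff.not.mpr hσ)
  let S := LinearMap.range (permW F n σ - LinearMap.id)
  have hle : LinearMap.range (permDel F n σ - LinearMap.id) ≤ S.map (Nsub F n).mkQ := by
    rintro _ ⟨v, rfl⟩
    obtain ⟨x, rfl⟩ := Submodule.Quotient.mk_surjective _ v
    exact ⟨_, ⟨x, rfl⟩, rfl⟩
  let φ : S →ₗ[F] (σ.support.erase i₀ → F) :=
    LinearMap.funLeft F F (fun j : σ.support.erase i₀ => (j : Fin n)) ∘ₗ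
      (Wsub F n).subtype ∘ₗ S.subtype
  have hφ : Function.Injective φ := by
    rw [injective_iff_map_eq_zero]
    intro y hy
    have hoff : ∀ i, i ≠ i₀ → ((y : Wsub F n) : Fin n → F) i = 0 := by
      intro i hi
      by_cases his : i ∈ σ.support
      · exact congrFun hy ⟨i, Finset.mem_erase.mpr ⟨hi, his⟩⟩
      · obtain ⟨x, hx⟩ := y.2
        have hfix : σ⁻¹ i = i := by
          rw [Equiv.Perm.inv_eq_iff_eq]
          exact (Equiv.Perm.notMem_support.mp his).symm
        rw [← hx]
        change ((x : Fin n → F) (σ⁻¹ i) - (x : Fin n → F) i) = 0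
        rw [hfix, sub_self]
    have hsum := mem_Wsub.mp (y : Wsub F n).2
    rw [Finset.sum_eq_single i₀ (fun i _ hi => hoff i hi) (by simp)] at hsum
    refine Subtype.ext (Subtype.ext (funext fun i => ?_))
    rcases eq_or_ne i i₀ with rfl | hi
    · exact hsum
    · exact hoff i hi
  calc _ ≤ Module.finrank F (S.map (Nsub F n).mkQ) := Submodule.finrank_mono hle
    _ ≤ Module.finrank F S := Submodule.finrank_map_le _ _
    _ ≤ Module.finrank F (σ.support.erase i₀ → F) := LinearMap.finrank_le_finrank_of_injective hφ
    _ = σ.support.card - 1 := by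
      rw [Module.finrank_fintype_fun_eq_card, Fintype.card_coe, Finset.card_erase_of_mem hi₀]

theorem le_finrank_delMod : n - 2 ≤ Module.finrank F (DelMod F n) := by
  have h1 := LinearMap.finrank_range_add_finrank_ker (sumCoords F n)
  rw [Module.finrank_fin_fun] at h1
  have h2 : Module.finrank F (LinearMap.range (sumCoords F n)) ≤ 1 :=
    (Submodule.finrank_le _).trans_eq (Module.finrank_self F)
  have h3 : Module.finrank F (DelMod F n) + _ = _ := (Nsub F n).finrank_quotient_add_finrank
  have h4 : Module.finrank F (Nsub F n) ≤ 1 := by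
    have hm : (Nsub F n).map (Wsub F n).subtype ≤ Dsub F n := by
      rintro _ ⟨x, hx, rfl⟩
      exact hx.2
    rw [((Nsub F n).equivMapOfInjective _ (Wsub F n).subtype_injective).finrank_eq]
    exact (Submodule.finrank_mono hm).trans ((finrank_span_le_card _).trans (by simp))
  change _ + Module.finrank F (Wsub F n) = n at h1
  omega

/-- If the order of `σ` is invertible in `F`, fixed vectors of the fully deleted permutation
module lift to vectors that are constant on the cycles of `σ`. -/
theorem exists_lift_of_permDel_eq (hσ : σ ^ r = 1) (hr : (r : F) ≠ 0) {v : DelMod F n}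
    (hv : permDel F n σ v = v) : ∃ x : Wsub F n, Submodule.Quotient.mk x = v ∧
      ∀ i j, σ.SameCycle i j → (x : Fin n → F) i = (x : Fin n → F) j := by
  obtain ⟨x, rfl⟩ := Submodule.Quotient.mk_surjective _ v
  rw [permDel_mk, Submodule.Quotient.eq] at hv
  have hfix : permW F n σ (permW F n σ x - x) = permW F n σ x - x := by
    obtain ⟨c, hc⟩ := mem_Nsub.mp hv
    ext i
    rw [permW_apply, hc, hc]
  have hpow : permW F n σ ^ r = 1 := by
    rw [permW_pow, hσ]
    rfl
  have h0 := Module.End.eq_zero_of_apply_eq_add hpow hr (x := x) (by abel) hfix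
  have hstep : ∀ i, (x : Fin n → F) (σ i) = (x : Fin n → F) i := by
    intro i
    have := congrFun (congrArg Subtype.val (sub_eq_zero.mp h0)) (σ i)
    rw [permW_apply, Equiv.Perm.inv_def, Equiv.symm_apply_apply] at this
    exact this.symm
  refine ⟨x, rfl, ?_⟩
  intro i j hij
  obtain ⟨k, -, rfl⟩ := hij.exists_pow_eq'
  induction k with
  | zero => rfl
  | succ k ih =>
    rw [pow_succ', Equiv.Perm.mul_apply, hstep]
    exact ih ⟨k, by simp⟩

end DeletedPermutationModule

theorem dvd_sub_one_of_primitive_prime_divisor {q e r : ℕ} (hr : r.Prime) (hq : 0 < q) (he : 0 < e)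
    (hdvd : r ∣ q ^ e - 1) (hppd : ∀ i, 1 ≤ i → i < e → ¬ r ∣ q ^ i - 1) : e ∣ r - 1 := by
  have : Fact r.Prime := ⟨hr⟩
  have hiff : ∀ i, r ∣ q ^ i - 1 ↔ (q : ZMod r) ^ i = 1 := by
    intro i
    rw [← Nat.modEq_iff_dvd' (Nat.one_le_pow _ _ hq), ← ZMod.natCast_eq_natCast_iff]
    push_cast
    exact eq_comm
  have hpow := (hiff e).mp hdvd
  have hne : (q : ZMod r) ≠ 0 := by
    rintro h
    rw [h, zero_pow he.ne'] at hpow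
    exact zero_ne_one hpow
  have hord : orderOf (q : ZMod r) = e := by
    refine (Nat.le_of_dvd he (orderOf_dvd_of_pow_eq_one hpow)).antisymm (not_lt.mp fun h => ?_)
    refine hppd _ ?_ h ((hiff _).mpr (pow_orderOf_eq_one _))
    exact orderOf_pos_iff.mpr (isOfFinOrder_iff_pow_eq_one.mpr ⟨e, he, hpow⟩)
  exact hord ▸ ZMod.orderOf_dvd_card_sub_one hne

theorem ne_of_dvd_of_dvd_pow_sub_one {p q e r : ℕ} (hp : p.Prime) (hpq : p ∣ q) (hq : 0 < q)
    (he : e ≠ 0) (hdvd : r ∣ q ^ e - 1) : p ≠ r := by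
  rintro rfl
  have h := (Nat.dvd_sub_iff_right (Nat.one_le_pow _ _ hq) (dvd_pow hpq he)).mp hdvd
  exact hp.one_lt.ne' (Nat.dvd_one.mp h)

theorem Equiv.Perm.exists_disjoint_cycles_of_cycleType_eq_replicate_two {α : Type*} [Fintype α]
    [DecidableEq α] {g : Equiv.Perm α} {r : ℕ} (h : g.cycleType = Multiset.replicate 2 r) :
    ∃ c₁ c₂ : Equiv.Perm α, c₁.IsCycle ∧ c₂.IsCycle ∧ c₁.support.card = r ∧
      c₂.support.card = r ∧ c₁.Disjoint c₂ ∧ g = c₁ * c₂ := by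
  have hg : g ≠ 1 := by
    rintro rfl
    simp at h
  obtain ⟨c, hc⟩ := Finset.nonempty_iff_ne_empty.mpr (cycleFactorsFinset_eq_empty_iff.not.mpr hg)
  have hcyc := (mem_cycleFactorsFinset_iff.mp hc).1
  have hcard : c.support.card = r := by
    refine Multiset.eq_of_mem_replicate (n := 2) (h ▸ ?_)
    rw [cycleType_def]
    exact Multiset.mem_map_of_mem _ hc
  have hrest : (g * c⁻¹).cycleType = {r} := by
    rw [cycleType_mul_inv_mem_cycleFactorsFinset_eq_sub hc, h, hcyc.cycleType, hcard]
    simp [Multiset.replicate_succ]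
  refine ⟨g * c⁻¹, c, ?_, hcyc, ?_, hcard, disjoint_mul_inv_of_mem_cycleFactorsFinset hc, by simp⟩
  · rw [← card_cycleType_eq_one, hrest, Multiset.card_singleton]
  · rw [← sum_cycleType, hrest, Multiset.sum_singleton]

section FixedVectors

variable {F : Type*} [Field F] {n r : ℕ} {g : Equiv.Perm (Fin n)}

theorem eq_zero_of_permDel_eq_of_isCycle (hσ : g ^ r = 1) (hr : (r : F) ≠ 0)
    (hg : g.IsCycle) (hcard : g.support.card = n) {v : DelMod F n} (hv : permDel F n g v = v) :
    v = 0 := by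
  obtain ⟨x, rfl, hx⟩ := exists_lift_of_permDel_eq hσ hr hv
  have hmem : ∀ i, i ∈ g.support := by
    rw [← Finset.eq_univ_iff_forall, ← Finset.card_eq_iff_eq_univ, hcard, Fintype.card_fin]
  obtain ⟨i₀, -⟩ := hg.nonempty_support
  rw [Submodule.Quotient.mk_eq_zero, mem_Nsub]
  exact ⟨_, fun i => hx i i₀ (hg.sameCycle (Equiv.Perm.mem_support.mp (hmem i))
    (Equiv.Perm.mem_support.mp (hmem i₀)))⟩

theorem eq_zero_of_permDel_eq_of_isCycle_of_cast_eq_zero (hσ : g ^ r = 1) (hr : (r : F) ≠ 0)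
    (hn0 : (n : F) = 0) (hn : 1 ≤ n)
    (hg : g.IsCycle) (hcard : g.support.card = n - 1) {v : DelMod F n}
    (hv : permDel F n g v = v) : v = 0 := by
  obtain ⟨x, rfl, hx⟩ := exists_lift_of_permDel_eq hσ hr hv
  obtain ⟨i₀, hi₀⟩ := hg.nonempty_support
  have hsupp : ∀ i ∈ g.support, (x : Fin n → F) i = (x : Fin n → F) i₀ := fun i hi =>
    hx i i₀ (hg.sameCycle (Equiv.Perm.mem_support.mp hi) (Equiv.Perm.mem_support.mp hi₀))
  obtain ⟨b, hb⟩ : ∃ b, g.supportᶜ = {b} := by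
    rw [← Finset.card_eq_one, Finset.card_compl, hcard, Fintype.card_fin]
    omega
  have hsum := mem_Wsub.mp x.2
  rw [← Finset.sum_add_sum_compl g.support, hb, Finset.sum_singleton, Finset.sum_congr rfl hsupp,
    Finset.sum_const, hcard, nsmul_eq_mul, Nat.cast_sub hn, hn0] at hsum
  have hxb : (x : Fin n → F) b = (x : Fin n → F) i₀ := by
    linear_combination hsum
  rw [Submodule.Quotient.mk_eq_zero, mem_Nsub]
  refine ⟨(x : Fin n → F) i₀, fun i => ?_⟩
  by_cases hi : i ∈ g.support
  · exact hsupp i hi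
  · rw [← Finset.mem_compl, hb, Finset.mem_singleton] at hi
    rw [hi, hxb]

theorem eq_zero_of_permDel_eq_of_two_cycles [CharP F 2] (hσ : g ^ r = 1) (hr : (r : F) ≠ 0)
    (hn : n = r + r) {c₁ c₂ : Equiv.Perm (Fin n)} (h₁ : c₁.IsCycle) (h₂ : c₂.IsCycle)
    (hc₁ : c₁.support.card = r) (hc₂ : c₂.support.card = r) (hd : c₁.Disjoint c₂)
    (hg : g = c₁ * c₂) {v : DelMod F n} (hv : permDel F n g v = v) : v = 0 := by
  obtain ⟨x, rfl, hx⟩ := exists_lift_of_permDel_eq hσ hr hv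
  have hconst : ∀ c ∈ g.cycleFactorsFinset, ∀ i ∈ c.support, ∀ j ∈ c.support,
      (x : Fin n → F) i = (x : Fin n → F) j := by
    intro c hc i hi j hj
    rw [Equiv.Perm.cycle_is_cycleOf hi hc, Equiv.Perm.mem_support_cycleOf_iff] at hj
    exact hx i j hj.1
  have hfac : g.cycleFactorsFinset = {c₁, c₂} := by
    rw [hg, hd.cycleFactorsFinset_mul_eq_union, h₁.cycleFactorsFinset_eq_singleton,
      h₂.cycleFactorsFinset_eq_singleton]
    rfl
  obtain ⟨a, ha⟩ := h₁.nonempty_support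
  obtain ⟨b, hb⟩ := h₂.nonempty_support
  have hxa : ∀ i ∈ c₁.support, (x : Fin n → F) i = (x : Fin n → F) a := fun i hi =>
    hconst c₁ (by simp [hfac]) i hi a ha
  have hxb : ∀ i ∈ c₂.support, (x : Fin n → F) i = (x : Fin n → F) b := fun i hi =>
    hconst c₂ (by simp [hfac]) i hi b hb
  have hdis := hd.disjoint_support
  have huniv : c₁.support ∪ c₂.support = Finset.univ := by
    rw [← Finset.card_eq_iff_eq_univ, Finset.card_union_of_disjoint hdis, hc₁, hc₂,
      Fintype.card_fin, hn]
  have hsum := mem_Wsub.mp x.2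
  rw [← huniv, Finset.sum_union hdis, Finset.sum_congr rfl hxa, Finset.sum_congr rfl hxb,
    Finset.sum_const, Finset.sum_const, hc₁, hc₂, ← smul_add, nsmul_eq_mul] at hsum
  have hab := CharTwo.add_eq_zero.mp ((mul_eq_zero.mp hsum).resolve_left hr)
  rw [Submodule.Quotient.mk_eq_zero, mem_Nsub]
  refine ⟨(x : Fin n → F) a, fun i => ?_⟩
  rcases Finset.mem_union.mp (huniv ▸ Finset.mem_univ i) with hi | hi
  · exact hxa i hi
  · rw [hxb i hi, hab]

end FixedVectors

/-- The possible cycle shapes of an element of order a primitive prime divisor of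
`q ^ (d / 2) - 1`. -/
theorem cases_of_primitive_prime_divisor {n p q r d : ℕ} (hn : 5 ≤ n) (hp : p.Prime)
    (hpq : p ∣ q) (hq : 0 < q) (hd : d = n - if p ∣ n then 2 else 1) (hdeven : Even d)
    {g : Equiv.Perm (Fin n)} (hr : r.Prime) (hord : orderOf g = r)
    (hdvd : r ∣ q ^ (d / 2) - 1) (hppd : ∀ i, 1 ≤ i → i < d / 2 → ¬ r ∣ q ^ i - 1) :
    Case1 n p d r g ∨ Case2 n p d r g ∨ Case3 n d r g ∨ Case4 n p d r g := by
  obtain ⟨e, he⟩ := hdeven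
  have hde : d / 2 = e := by omega
  have hnd : (p ∣ n ∧ n = d + 2) ∨ (¬ p ∣ n ∧ n = d + 1) := by
    split_ifs at hd with h
    · exact Or.inl ⟨h, by omega⟩
    · exact Or.inr ⟨h, by omega⟩
  have he2 : 2 ≤ e := by omega
  have hpr : p ≠ r := ne_of_dvd_of_dvd_pow_sub_one hp hpq hq (by omega) hdvd
  obtain ⟨k, hk⟩ := dvd_sub_one_of_primitive_prime_divisor hr hq (by omega) hdvd hppd
  rw [hde] at hk
  have hr2 := hr.two_le
  obtain ⟨c, hc⟩ := Equiv.Perm.cycleType_prime_order (hord ▸ hr)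
  rw [hord] at hc
  have hsupp : g.support.card = (c + 1) * r := by
    rw [← Equiv.Perm.sum_cycleType, hc, Multiset.sum_replicate, smul_eq_mul]
  have hle : (c + 1) * r ≤ n := by
    rw [← hsupp]
    exact (Finset.card_le_univ _).trans_eq (Fintype.card_fin n)
  have hk1 : k ≠ 0 := by
    rintro rfl
    omega
  have hk3 : k < 3 := by
    by_contra! h
    have h1 := Nat.mul_le_mul_left e h
    have h2 : r ≤ (c + 1) * r := Nat.le_mul_of_pos_left r c.succ_pos
    omega
  have hc2 : c < 2 := by
    by_contra! h
    have h1 := Nat.mul_le_mul_left e (Nat.one_le_iff_ne_zero.mpr hk1)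
    have h2 : 3 * r ≤ (c + 1) * r := Nat.mul_le_mul_right r (Nat.succ_le_succ h)
    omega
  have hcycle : c = 0 → g.IsCycle := by
    rintro rfl
    rw [← Equiv.Perm.card_cycleType_eq_one, hc, Multiset.card_replicate]
  obtain rfl | rfl : k = 1 ∨ k = 2 := by omega
  · right; right
    obtain rfl | rfl : c = 0 ∨ c = 1 := by omega
    · exact Or.inl ⟨by omega, hcycle rfl, by omega⟩
    · have hn2 : n = 2 * r := by omega
      have hpn : p ∣ n := by
        rcases hnd with h | h
        · exact h.1
        · omega
      refine Or.inr ⟨by omega, by omega, ?_,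
        Equiv.Perm.exists_disjoint_cycles_of_cycleType_eq_replicate_two hc⟩
      rcases hp.dvd_mul.mp (hn2 ▸ hpn) with h | h
      · exact (Nat.prime_dvd_prime_iff_eq hp Nat.prime_two).mp h
      · exact absurd ((Nat.prime_dvd_prime_iff_eq hp hr).mp h) hpr
  · obtain rfl : c = 0 := by
      by_contra h
      obtain rfl : c = 1 := by omega
      omega
    rcases hnd with h | h
    · exact Or.inr (Or.inl ⟨by omega, h.1, h.2, hcycle rfl, by omega⟩)
    · exact Or.inl ⟨by omega, h.1, h.2, hcycle rfl, by omega⟩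

/-- Let `n ≥ 5`, `q = p^a`, `δ = 1` if `p ∤ n` and `δ = 2` if `p ∣ n`, `d = n - δ` even.
Let `g ∈ Aₙ` have order `r`, a primitive prime divisor of `q^{d/2} - 1`.  Then exactly one
of the four cases (1)–(4) holds, and `g` acts on the fully deleted permutation module as a
`(d/2)`-stingray element if and only if case (3) holds. -/
theorem stmt8 (n p a q r : ℕ) (hn : 5 ≤ n) (hp : p.Prime) (ha : 0 < a) (hq : q = p ^ a)
    (F : Type*) [Field F] [Fintype F] (hF : Fintype.card F = q)
    (δ d : ℕ) (hδ : δ = if p ∣ n then 2 else 1) (hd : d = n - δ) (hdeven : Even d)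
    (g : Equiv.Perm (Fin n)) (hgeven : Equiv.Perm.sign g = 1)
    (hr : r.Prime) (hord : orderOf g = r)
    (hdvd : r ∣ q ^ (d / 2) - 1)
    (hppd : ∀ i, 1 ≤ i → i < d / 2 → ¬ r ∣ q ^ i - 1) :
    ((Case1 n p d r g ∧ ¬ Case2 n p d r g ∧ ¬ Case3 n d r g ∧ ¬ Case4 n p d r g) ∨
     (¬ Case1 n p d r g ∧ Case2 n p d r g ∧ ¬ Case3 n d r g ∧ ¬ Case4 n p d r g) ∨
     (¬ Case1 n p d r g ∧ ¬ Case2 n p d r g ∧ Case3 n d r g ∧ ¬ Case4 n p d r g) ∨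
     (¬ Case1 n p d r g ∧ ¬ Case2 n p d r g ∧ ¬ Case3 n d r g ∧ Case4 n p d r g)) ∧
    (IsStingrayOn F (permDel F n g) (d / 2) ↔ Case3 n d r g) := by
  subst hδ hq
  have hq : 0 < p ^ a := Nat.pow_pos hp.pos
  have hall := cases_of_primitive_prime_divisor hn hp (dvd_pow_self p ha.ne') hq hd hdeven hr hord
    hdvd hppd
  have hd4 : 4 ≤ d := by
    obtain ⟨e, he⟩ := hdeven
    split_ifs at hd <;> omega
  have h12 : Case1 n p d r g → ¬ Case2 n p d r g := fun h h' => h.2.1 h'.2.1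
  have h13 : Case1 n p d r g → ¬ Case3 n d r g := fun h h' => by
    have := h.1; have := h'.1; omega
  have h14 : Case1 n p d r g → ¬ Case4 n p d r g := fun h h' => by
    have := h.1; have := h'.1; omega
  have h23 : Case2 n p d r g → ¬ Case3 n d r g := fun h h' => by
    have := h.1; have := h'.1; omega
  have h24 : Case2 n p d r g → ¬ Case4 n p d r g := fun h h' => by
    have := h.1; have := h'.1; omega
  have h34 : Case3 n d r g → ¬ Case4 n p d r g := by
    rintro ⟨-, -, h⟩ ⟨-, -, -, c₁, c₂, -, -, h₁, h₂, hdis, rfl⟩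
    rw [hdis.card_support_mul] at h
    have := hr.pos
    omega
  refine ⟨?_, ?_⟩
  · rcases hall with h | h | h | h
    · exact Or.inl ⟨h, h12 h, h13 h, h14 h⟩
    · exact Or.inr (Or.inl ⟨fun h' => h12 h' h, h, h23 h, h24 h⟩)
    · exact Or.inr (Or.inr (Or.inl ⟨fun h' => h13 h' h, fun h' => h23 h' h, h, h34 h⟩))
    · exact Or.inr (Or.inr (Or.inr ⟨fun h' => h14 h' h, fun h' => h24 h' h, fun h' => h34 h' h, h⟩))
  have hgr : g ^ r = 1 := hord ▸ pow_orderOf_eq_one g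
  have : Fact p.Prime := ⟨hp⟩
  have : CharP F p := charP_of_card_eq_prime_pow hF
  have hrF : (r : F) ≠ 0 := by
    rw [Ne, CharP.cast_eq_zero_iff F p, Nat.prime_dvd_prime_iff_eq hp hr]
    exact ne_of_dvd_of_dvd_pow_sub_one hp (dvd_pow_self p ha.ne') hq (by omega) hdvd
  constructor
  · intro hst
    have hcontra : ¬ ∀ v, permDel F n g v = v → v = 0 := by
      intro hfix
      have h1 := hst.finrank_eq_of_fixed_eq_zero hfix
      have h2 := le_finrank_delMod (F := F) (n := n)
      have h3 : d ≤ n - 1 := by split_ifs at hd <;> omega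
      omega
    rcases hall with h | h | h | h
    · exact absurd (fun v => eq_zero_of_permDel_eq_of_isCycle hgr hrF h.2.2.2.1 h.2.2.2.2) hcontra
    · exact absurd (fun v => eq_zero_of_permDel_eq_of_isCycle_of_cast_eq_zero hgr hrF
        ((CharP.cast_eq_zero_iff F p n).mpr h.2.1) (by omega) h.2.2.2.1 h.2.2.2.2) hcontra
    · exact h
    · obtain ⟨hrd, hrn, rfl, c₁, c₂, h₁, h₂, hc₁, hc₂, hdis, hg⟩ := h
      refine absurd (fun v => eq_zero_of_permDel_eq_of_two_cycles hgr hrF ?_ h₁ h₂ hc₁ hc₂ hdis hg)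
        hcontra
      have hle : (c₁.support ∪ c₂.support).card ≤ n :=
        (Finset.card_le_univ _).trans_eq (Fintype.card_fin n)
      obtain ⟨e, he⟩ := hdeven
      split_ifs at hd <;> omega
  · rintro ⟨hrd, -, hcard⟩
    refine isStingrayOn_of_finrank_range_le hr (permDel_pow_eq_one hgr) hrF (hF ▸ hppd)
      (permDel_ne_one hn ?_) ?_
    · rintro rfl
      rw [orderOf_one] at hord
      exact hr.one_lt.ne hord
    · refine finrank_range_permDel_sub_id_le.trans ?_
      omega
end

section
/- Let n ∈ {13, 14} and let g ∈ A_n be an element of order 9. Then the fixed-point subspace of g on the fully deleted permutation module V for A_n over 𝔽₂ (which has dimension 12) has dimension at most 4; in particular, g does not act on V as a 6-stingray element. -/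
theorem sumCoords_apply (F : Type*) [Field F] (n : ℕ) (x : Fin n → F) :
    sumCoords F n x = ∑ i, x i := by
  simp [sumCoords]

theorem sum_coe_Wsub (F : Type*) [Field F] (n : ℕ) (x : Wsub F n) :
    ∑ i, (x : Fin n → F) i = 0 :=
  (sumCoords_apply F n x).symm.trans x.2

theorem coe_permW_apply (F : Type*) [Field F] (n : ℕ) (σ : Equiv.Perm (Fin n))
    (x : Wsub F n) (i : Fin n) :
    (permW F n σ x : Fin n → F) i = (x : Fin n → F) (σ⁻¹ i) := rfl

theorem finrank_Wsub (F : Type*) [Field F] (n : ℕ) (hn : 0 < n) :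
    Module.finrank F (Wsub F n) + 1 = n := by
  have hsurj : Function.Surjective (sumCoords F n) := fun c =>
    ⟨Pi.single ⟨0, hn⟩ c, by simp [sumCoords_apply]⟩
  have h := LinearMap.finrank_range_add_finrank_ker (sumCoords F n)
  rw [LinearMap.range_eq_top.mpr hsurj, finrank_top, Module.finrank_self,
    Module.finrank_fin_fun, add_comm] at h
  exact h

theorem mem_Nsub_iff (F : Type*) [Field F] (n : ℕ) (x : Wsub F n) :
    x ∈ Nsub F n ↔ ∃ c : F, ∀ i, (x : Fin n → F) i = c := by
  have h : x ∈ Nsub F n ↔ (x : Fin n → F) ∈ Dsub F n :=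
    ⟨fun hx => hx.2, fun hx => ⟨x.2, hx⟩⟩
  rw [h, Dsub, Submodule.mem_span_singleton]
  refine exists_congr fun c => ?_
  rw [funext_iff]
  exact forall_congr' fun i => by simp [eq_comm]

theorem Nsub_eq_bot (F : Type*) [Field F] (n : ℕ) (hn : (n : F) ≠ 0) : Nsub F n = ⊥ := by
  rw [eq_bot_iff]
  intro x hx
  obtain ⟨c, hc⟩ := (mem_Nsub_iff F n x).mp hx
  have hsum := sum_coe_Wsub F n x
  simp only [hc, Finset.sum_const, Finset.card_univ, Fintype.card_fin, nsmul_eq_mul,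
    mul_eq_zero, hn, false_or] at hsum
  rw [Submodule.mem_bot]
  ext i
  simp [hc, hsum]

theorem finrank_Nsub_eq_one (F : Type*) [Field F] (n : ℕ) (hn : (n : F) = 0) (hpos : 0 < n) :
    Module.finrank F (Nsub F n) = 1 := by
  have hone : (fun _ => 1 : Fin n → F) ∈ Wsub F n := by
    rw [Wsub, LinearMap.mem_ker, sumCoords_apply]
    simp [hn]
  have hspan : Nsub F n = Submodule.span F {(⟨_, hone⟩ : Wsub F n)} := by
    ext x
    rw [mem_Nsub_iff, Submodule.mem_span_singleton]
    refine exists_congr fun c => ?_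
    rw [Subtype.ext_iff, funext_iff]
    exact forall_congr' fun i => by simp [eq_comm]
  rw [hspan]
  refine finrank_span_singleton fun h => one_ne_zero (α := F) ?_
  exact congrFun (congrArg Subtype.val h) ⟨0, hpos⟩

theorem apply_pow_of_fixed {F : Type*} [Field F] {n : ℕ} {σ : Equiv.Perm (Fin n)} {c : F}
    {x : Fin n → F} (hx : ∀ i, x (σ⁻¹ i) = x i + c) (a : Fin n) (k : ℕ) :
    x a = x ((σ ^ k) a) + k * c := by
  induction k with
  | zero => simp
  | succ k ih =>
    have h := hx ((σ ^ (k + 1)) a)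
    rw [pow_succ', Equiv.Perm.mul_apply, Equiv.Perm.inv_eq_iff_eq.mpr rfl] at h
    rw [ih, h, pow_succ', Equiv.Perm.mul_apply]
    push_cast
    ring

/-- If the order of `σ` is nonzero in `F`, every fixed vector of `V` lifts to one of `W`. -/
theorem comap_ker_permDel_sub_id (F : Type*) [Field F] (n : ℕ) (σ : Equiv.Perm (Fin n))
    (hσ : (orderOf σ : F) ≠ 0) :
    (LinearMap.ker (permDel F n σ - LinearMap.id)).comap (Nsub F n).mkQ =
      LinearMap.ker (permW F n σ - LinearMap.id) := by
  ext x
  have hmem : x ∈ (LinearMap.ker (permDel F n σ - LinearMap.id)).comap (Nsub F n).mkQ ↔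
      permW F n σ x - x ∈ Nsub F n := by
    rw [Submodule.mem_comap, LinearMap.mem_ker, LinearMap.sub_apply, LinearMap.id_apply,
      Submodule.mkQ_apply, permDel, Submodule.mapQ_apply, ← Submodule.Quotient.mk_sub,
      Submodule.Quotient.mk_eq_zero]
  rw [hmem, LinearMap.mem_ker, LinearMap.sub_apply, LinearMap.id_apply]
  refine ⟨fun h => ?_, fun h => h ▸ zero_mem _⟩
  obtain ⟨c, hc⟩ := (mem_Nsub_iff F n _).mp h
  have hx : ∀ i, (x : Fin n → F) (σ⁻¹ i) = (x : Fin n → F) i + c := fun i => by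
    rw [← hc i, Submodule.coe_sub, Pi.sub_apply, coe_permW_apply]
    ring
  ext i
  have hpow := apply_pow_of_fixed hx i (orderOf σ)
  rw [pow_orderOf_eq_one, Equiv.Perm.one_apply, left_eq_add] at hpow
  rw [hc i, (mul_eq_zero.mp hpow).resolve_left hσ]
  rfl

/-- A fixed vector of `W` is constant on an orbit, so it is determined by its values off an
orbit whose length is nonzero in `F`. -/
theorem finrank_ker_permW_sub_id_le (F : Type*) [Field F] (n : ℕ) (σ : Equiv.Perm (Fin n))
    (a : Fin n) (m : ℕ) (hm : Function.minimalPeriod σ a = m) (hmF : (m : F) ≠ 0) :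
    Module.finrank F (LinearMap.ker (permW F n σ - LinearMap.id)) ≤ n - m := by
  classical
  set O : Finset (Fin n) := (Finset.range m).image fun k => (σ ^ k) a with hO
  have hcard : O.card = m := by
    rw [hO, Finset.card_image_of_injOn, Finset.card_range]
    intro i hi j hj hij
    simp only [Finset.coe_range, Set.mem_Iio, ← hm] at hi hj
    exact Function.iterate_injOn_Iio_minimalPeriod hi hj
      (by simpa [Equiv.Perm.iterate_eq_pow] using hij)
  let r : LinearMap.ker (permW F n σ - LinearMap.id) →ₗ[F] ({i // i ∉ O} → F) :=
    LinearMap.funLeft F F Subtype.val ∘ₗ (Wsub F n).subtype ∘ₗ Submodule.subtype _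
  have hr : Function.Injective r := by
    rw [injective_iff_map_eq_zero]
    rintro ⟨x, hx⟩ hrx
    rw [LinearMap.mem_ker, LinearMap.sub_apply, LinearMap.id_apply, sub_eq_zero] at hx
    have hfix : ∀ i, (x : Fin n → F) (σ⁻¹ i) = (x : Fin n → F) i + 0 := fun i => by
      rw [← coe_permW_apply, hx, add_zero]
    have hoff : ∀ i, i ∉ O → (x : Fin n → F) i = 0 := fun i hi => congrFun hrx ⟨i, hi⟩
    have hon : ∀ i ∈ O, (x : Fin n → F) i = (x : Fin n → F) a := fun i hi => by
      obtain ⟨k, -, rfl⟩ := Finset.mem_image.mp hi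
      rw [apply_pow_of_fixed hfix a k, mul_zero, add_zero]
    have hsum := sum_coe_Wsub F n x
    rw [← Finset.sum_subset O.subset_univ fun i _ hi => hoff i hi, Finset.sum_congr rfl hon,
      Finset.sum_const, hcard, nsmul_eq_mul] at hsum
    have ha := (mul_eq_zero.mp hsum).resolve_left hmF
    ext i
    by_cases hi : i ∈ O
    · exact (hon i hi).trans ha
    · exact hoff i hi
  refine (LinearMap.finrank_le_finrank_of_injective hr).trans ?_
  rw [Module.finrank_fintype_fun_eq_card, Fintype.card_subtype_compl, Fintype.card_fin,
    Fintype.card_coe, hcard]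

theorem exists_minimalPeriod_eq_of_orderOf_eq_prime_pow {α : Type*} (σ : Equiv.Perm α)
    {p k : ℕ} (hp : p.Prime) (hσ : orderOf σ = p ^ (k + 1)) :
    ∃ a, Function.minimalPeriod σ a = p ^ (k + 1) := by
  have hne : σ ^ p ^ k ≠ 1 := fun h => by
    have := Nat.le_of_dvd (pow_pos hp.pos _) (orderOf_dvd_of_pow_eq_one h)
    rw [hσ] at this
    exact absurd this (Nat.pow_lt_pow_right hp.one_lt k.lt_succ_self).not_ge
  obtain ⟨a, ha⟩ := not_forall.mp (mt Equiv.ext hne)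
  have := Fact.mk hp
  refine ⟨a, Function.minimalPeriod_eq_prime_pow ?_ ?_⟩
  · rw [Function.IsPeriodicPt, Function.IsFixedPt, Equiv.Perm.iterate_eq_pow]
    exact ha
  · rw [Function.IsPeriodicPt, Function.IsFixedPt, Equiv.Perm.iterate_eq_pow, ← hσ,
      pow_orderOf_eq_one, Equiv.Perm.one_apply]

theorem finrank_comap_mkQ {F M : Type*} [Field F] [AddCommGroup M] [Module F M]
    [FiniteDimensional F M] (N : Submodule F M) (K : Submodule F (M ⧸ N)) :
    Module.finrank F (K.comap N.mkQ) = Module.finrank F K + Module.finrank F N := by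
  have h := ((N.mkQ).domRestrict (K.comap N.mkQ)).finrank_range_add_finrank_ker
  rw [LinearMap.range_domRestrict, Submodule.map_comap_eq_of_surjective N.mkQ_surjective,
    LinearMap.ker_domRestrict, Submodule.ker_mkQ] at h
  rw [← h, (Submodule.comapSubtypeEquivOfLe (Submodule.le_comap_mkQ N K)).finrank_eq]

theorem finrank_DelMod_add (F : Type*) [Field F] (n : ℕ) (hn : 0 < n) :
    Module.finrank F (DelMod F n) + Module.finrank F (Nsub F n) + 1 = n := by
  rw [Submodule.finrank_quotient_add_finrank, finrank_Wsub F n hn]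

theorem finrank_of_isStingrayOn {F M : Type*} [Field F] [AddCommGroup M] [Module F M]
    [FiniteDimensional F M] {g : Module.End F M} {e : ℕ} (hg : IsStingrayOn F g e) :
    e + Module.finrank F (LinearMap.ker (g - LinearMap.id)) = Module.finrank F M := by
  obtain ⟨U, hU, -, hcompl, -⟩ := hg
  rw [← hU, Submodule.finrank_add_eq_of_isCompl hcompl]

theorem finrank_ker_permDel_sub_id_add_le (F : Type*) [Field F] (n : ℕ)
    (σ : Equiv.Perm (Fin n)) (hσ : (orderOf σ : F) ≠ 0) (a : Fin n) (m : ℕ)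
    (hm : Function.minimalPeriod σ a = m) (hmF : (m : F) ≠ 0) :
    Module.finrank F (LinearMap.ker (permDel F n σ - LinearMap.id)) +
      Module.finrank F (Nsub F n) ≤ n - m := by
  rw [← finrank_comap_mkQ, comap_ker_permDel_sub_id F n σ hσ]
  exact finrank_ker_permW_sub_id_le F n σ a m hm hmF

/-- Let `n ∈ {13, 14}` and let `g ∈ Aₙ` have order `9`.  Then the fixed-point subspace
of `g` on the fully deleted permutation module `V` for `Aₙ` over `𝔽₂` (which has
dimension `12`) has dimension at most `4`; in particular `g` does not act on `V` as a
`6`-stingray element. -/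
theorem stmt12 (n : ℕ) (hn : n = 13 ∨ n = 14)
    (g : Equiv.Perm (Fin n)) (hgA : Equiv.Perm.sign g = 1) (hord : orderOf g = 9) :
    Module.finrank (ZMod 2) (DelMod (ZMod 2) n) = 12 ∧
    Module.finrank (ZMod 2)
      ↥(LinearMap.ker (permDel (ZMod 2) n g - LinearMap.id)) ≤ 4 ∧
    ¬ IsStingrayOn (ZMod 2) (permDel (ZMod 2) n g) 6 := by
  have hnine : ((9 : ℕ) : ZMod 2) ≠ 0 := by decide
  have hN : Module.finrank (ZMod 2) (Nsub (ZMod 2) n) + 13 = n := by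
    rcases hn with rfl | rfl
    · rw [Nsub_eq_bot _ _ (by decide), finrank_bot]
    · rw [finrank_Nsub_eq_one _ _ (by decide) (by decide)]
  have hV : Module.finrank (ZMod 2) (DelMod (ZMod 2) n) = 12 := by
    have := finrank_DelMod_add (ZMod 2) n (by omega)
    omega
  have hfix : Module.finrank (ZMod 2)
      (LinearMap.ker (permDel (ZMod 2) n g - LinearMap.id)) ≤ 4 := by
    obtain ⟨a, ha⟩ := exists_minimalPeriod_eq_of_orderOf_eq_prime_pow g (k := 1)
      Nat.prime_three hord
    refine (Nat.le_sub_of_add_le (finrank_ker_permDel_sub_id_add_le (ZMod 2) n g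
      (by rwa [hord]) a 9 ha hnine)).trans ?_
    omega
  refine ⟨hV, hfix, fun hg => ?_⟩
  have := finrank_of_isStingrayOn hg
  omega
end
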